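/- Nonasymptotic convergence of DQ-AGD. Under the DQ-AGD algorithm, assume additionally ε ≤ 1 and p(σ_AGD) ≠ 0 where p(s) := s² − ε·(1+γ)·s − ε·γ. Then for every t ≥ 1, ‖ŷ_t − x*‖ ≤ σ_AGD^t·c + η·c_+·φ_+^{t−1} + η·c_−·φ_−^{t−1}, where c := √(κ+1)·D + η·c_0/σ_AGD, φ_± := (ε·(1+γ) ± √(ε²·(1+γ)² + 4·ε·γ))/2, c_0 := σ_AGD²·(L·D·λ)/p(σ_AGD), c_+ := −(c_0·φ_+²/σ_AGD²)·(σ_AGD − φ_−)/(φ_+ − φ_−), c_− := (c_0·φ_−²/σ_AGD²)·(σ_AGD − φ_+)/(φ_+ − φ_−). -/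

import Mathlib

/-- Lyapunov step of accelerated gradient descent: the potential
`f y - f x* + μ/2 ‖v - x*‖²` contracts by the factor `1 - 1/s`, where `s = √(L/μ)`,
`a = x - y`, `b = x - x*` and `g = ∇f x`. -/
lemma agd_potential_step {E : Type*} [NormedAddCommGroup E] [InnerProductSpace ℝ E]
    {μ L s fx fy fy' fs : ℝ} (hμ : 0 < μ) (hs : 1 < s) (hL : L = μ * s ^ 2) (a b g : E)
    (hdesc : fy' ≤ fx - 1 / (2 * L) * ‖g‖ ^ 2)
    (hfs : fx - inner ℝ g b + μ / 2 * ‖b‖ ^ 2 ≤ fs)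
    (hfy : fx - inner ℝ g a ≤ fy) :
    fy' - fs + μ / 2 * ‖b + (s - 1) • a - (s / L) • g‖ ^ 2
      ≤ (1 - 1 / s) * (fy - fs + μ / 2 * ‖b + s • a‖ ^ 2) := by
  have hs0 : 0 < s := by linarith
  have e1 : ‖b + (s - 1) • a - (s / L) • g‖ ^ 2 = ‖b‖ ^ 2 + (s - 1) ^ 2 * ‖a‖ ^ 2
      + (s / L) ^ 2 * ‖g‖ ^ 2 + 2 * (s - 1) * inner ℝ a b
      - 2 * (s / L) * inner ℝ g b - 2 * (s / L) * (s - 1) * inner ℝ g a := by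
    rw [norm_sub_sq_real, norm_add_sq_real, inner_add_left]
    simp only [norm_smul, mul_pow, inner_smul_left, inner_smul_right, Real.norm_eq_abs, sq_abs,
      RCLike.conj_to_real, real_inner_comm a b, real_inner_comm g a, real_inner_comm g b]
    ring
  have e2 : ‖b + s • a‖ ^ 2 = ‖b‖ ^ 2 + s ^ 2 * ‖a‖ ^ 2 + 2 * s * inner ℝ a b := by
    rw [norm_add_sq_real]
    simp only [norm_smul, mul_pow, inner_smul_right, Real.norm_eq_abs, sq_abs,
      real_inner_comm a b]
    ring
  rw [e1, e2]
  have h1 : 0 ≤ (1 - 1 / s) * (fy - (fx - inner ℝ g a)) :=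
    mul_nonneg (by rw [sub_nonneg, div_le_one hs0]; exact hs.le) (by linarith)
  have h2 : 0 ≤ (1 / s) * (fs - (fx - inner ℝ g b + μ / 2 * ‖b‖ ^ 2)) :=
    mul_nonneg (by positivity) (by linarith)
  have h3 : 0 ≤ μ / 2 * (s - 1) * ‖a‖ ^ 2 := by
    have : 0 ≤ s - 1 := by linarith
    positivity
  rw [← sub_nonneg]
  have key : (1 - 1 / s) * (fy - fs + μ / 2 * (‖b‖ ^ 2 + s ^ 2 * ‖a‖ ^ 2 + 2 * s * inner ℝ a b))
      - (fy' - fs + μ / 2 * (‖b‖ ^ 2 + (s - 1) ^ 2 * ‖a‖ ^ 2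
      + (s / L) ^ 2 * ‖g‖ ^ 2 + 2 * (s - 1) * inner ℝ a b
      - 2 * (s / L) * inner ℝ g b - 2 * (s / L) * (s - 1) * inner ℝ g a))
      = (1 - 1 / s) * (fy - (fx - inner ℝ g a))
      + (1 / s) * (fs - (fx - inner ℝ g b + μ / 2 * ‖b‖ ^ 2))
      + μ / 2 * (s - 1) * ‖a‖ ^ 2 + (fx - 1 / (2 * L) * ‖g‖ ^ 2 - fy') := by
    subst hL
    field_simp
    ring
  rw [key]
  linarith

section Gradient

variable {E : Type*} [NormedAddCommGroup E] [InnerProductSpace ℝ E] [CompleteSpace E]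

lemma hasDerivAt_comp_add_smul {f : E → ℝ} (hf : Differentiable ℝ f) (x d : E) (t : ℝ) :
    HasDerivAt (fun t : ℝ => f (x + t • d)) (inner ℝ (gradient f (x + t • d)) d) t := by
  have h1 : HasDerivAt (fun t : ℝ => x + t • d) d t := by
    simpa using ((hasDerivAt_id t).smul_const d).const_add x
  have h2 := (hf (x + t • d)).hasGradientAt.hasFDerivAt.comp_hasDerivAt t h1
  exact h2.congr_deriv (by simp)

/-- Quadratic upper bound for a function with Lipschitz gradient. -/
lemma le_quadratic_of_gradient_lipschitz {f : E → ℝ} {L : ℝ} (hf : Differentiable ℝ f)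
    (hsmooth : ∀ x y : E, ‖gradient f x - gradient f y‖ ≤ L * ‖x - y‖) (x d : E) :
    f (x + d) ≤ f x + inner ℝ (gradient f x) d + L / 2 * ‖d‖ ^ 2 := by
  let h : ℝ → ℝ := fun t => f (x + t • d) - t * inner ℝ (gradient f x) d - L / 2 * ‖d‖ ^ 2 * t ^ 2
  have hd : ∀ t, HasDerivAt h (inner ℝ (gradient f (x + t • d)) d - inner ℝ (gradient f x) d
      - L / 2 * ‖d‖ ^ 2 * (2 * t)) t := by
    intro t
    have h2 := (hasDerivAt_id t).mul_const (inner ℝ (gradient f x) d)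
    have h3 := ((hasDerivAt_id t).pow 2).const_mul (L / 2 * ‖d‖ ^ 2)
    exact (((hasDerivAt_comp_add_smul hf x d t).sub h2).sub h3).congr_deriv (by simp)
  have hanti : AntitoneOn h (Set.Icc 0 1) := by
    apply antitoneOn_of_deriv_nonpos (convex_Icc 0 1)
    · exact fun t _ => (hd t).continuousAt.continuousWithinAt
    · exact fun t _ => (hd t).differentiableAt.differentiableWithinAt
    · intro t ht
      rw [interior_Icc] at ht
      rw [(hd t).deriv, ← inner_sub_left]
      have h1 := real_inner_le_norm (gradient f (x + t • d) - gradient f x) d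
      have h2 := hsmooth (x + t • d) x
      rw [add_sub_cancel_left, norm_smul, Real.norm_of_nonneg ht.1.le] at h2
      nlinarith [mul_le_mul_of_nonneg_right h2 (norm_nonneg d)]
  have := hanti (Set.left_mem_Icc.2 zero_le_one) (Set.right_mem_Icc.2 zero_le_one) zero_le_one
  simp [h, -inner_gradient_left] at this
  linarith

/-- First-order lower bound for a strongly convex function. -/
lemma quadratic_le_of_strongly_convex {f : E → ℝ} {μ : ℝ} (hf : Differentiable ℝ f)
    (hconv : ConvexOn ℝ Set.univ (fun x : E => f x - μ / 2 * ‖x‖ ^ 2)) (x d : E) :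
    f x + inner ℝ (gradient f x) d + μ / 2 * ‖d‖ ^ 2 ≤ f (x + d) := by
  let h : ℝ → ℝ := fun t => f (x + t • d) - μ / 2 * ‖x + t • d‖ ^ 2
  have hc : ConvexOn ℝ Set.univ h := by
    refine ⟨convex_univ, fun a _ b _ p q hp hq hpq => ?_⟩
    have := hconv.2 (Set.mem_univ (x + a • d)) (Set.mem_univ (x + b • d)) hp hq hpq
    have e : p • (x + a • d) + q • (x + b • d) = x + (p • a + q • b) • d := by
      rw [smul_add, smul_add, add_smul, smul_smul, smul_smul, smul_eq_mul, smul_eq_mul]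
      nth_rewrite 3 [← one_smul ℝ x]
      rw [← hpq, add_smul]
      abel
    rwa [e] at this
  have hn : (fun t : ℝ => ‖x + t • d‖ ^ 2)
      = fun t => ‖x‖ ^ 2 + t * (2 * inner ℝ x d) + ‖d‖ ^ 2 * t ^ 2 := by
    funext t
    rw [norm_add_sq_real, norm_smul, inner_smul_right, mul_pow, Real.norm_eq_abs, sq_abs]
    ring
  have hd : HasDerivAt h (inner ℝ (gradient f x) d - μ / 2 * (2 * inner ℝ x d)) 0 := by
    have h1 := hasDerivAt_comp_add_smul hf x d 0
    have h2 : HasDerivAt (fun t : ℝ => ‖x + t • d‖ ^ 2) (2 * inner ℝ x d) 0 := by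
      rw [hn]
      exact ((((hasDerivAt_id (0 : ℝ)).mul_const (2 * inner ℝ x d)).const_add (‖x‖ ^ 2)).add
        (((hasDerivAt_id (0 : ℝ)).pow 2).const_mul (‖d‖ ^ 2))).congr_deriv (by simp)
    exact (h1.sub (h2.const_mul (μ / 2))).congr_deriv (by simp)
  have := hc.le_slope_of_hasDerivAt (Set.mem_univ 0) (Set.mem_univ 1) zero_lt_one hd
  have hn1 := congrFun hn 1
  simp [slope, h, -inner_gradient_left] at this hn1
  rw [hn1] at this
  linarith

lemma gradient_eq_zero_of_forall_le {f : E → ℝ} {xs : E} (hmin : ∀ x, f xs ≤ f x) :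
    gradient f xs = 0 := by
  have : IsLocalMin f xs := Filter.Eventually.of_forall hmin
  simp [gradient, this.fderiv_eq_zero]

/-- Linear convergence of exact accelerated gradient descent for an `L`-smooth, `μ`-strongly convex
function, with `s = √(L/μ)`. -/
lemma agd_norm_sq_le {f : E → ℝ} {μ L D s γ : ℝ} (hμ : 0 < μ) (hs : 1 < s) (hL : L = μ * s ^ 2)
    (hγ : γ = (s - 1) / (s + 1)) (hf : Differentiable ℝ f)
    (hsmooth : ∀ x y : E, ‖gradient f x - gradient f y‖ ≤ L * ‖x - y‖)
    (hconv : ConvexOn ℝ Set.univ (fun x : E => f x - μ / 2 * ‖x‖ ^ 2))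
    {xs : E} (hmin : ∀ x, f xs ≤ f x) {x y : ℕ → E} (hy0 : y 0 = x 0)
    (hy : ∀ t, y (t + 1) = x t - (1 / L) • gradient f (x t))
    (hx : ∀ t, x (t + 1) = y (t + 1) + γ • (y (t + 1) - y t))
    (hinit : ‖x 0 - xs‖ ≤ D) (t : ℕ) :
    ‖y t - xs‖ ^ 2 ≤ (1 - 1 / s) ^ t * ((s ^ 2 + 1) * D ^ 2) := by
  have hs0 : 0 < s := by linarith
  have hL0 : 0 < L := by rw [hL]; positivity
  have hθ : 0 ≤ 1 - 1 / s := by rw [sub_nonneg, div_le_one hs0]; exact hs.le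
  have hgrad := gradient_eq_zero_of_forall_le hmin
  have hpot : ∀ t, f (y t) - f xs + μ / 2 * ‖(x t - xs) + s • (x t - y t)‖ ^ 2
      ≤ (1 - 1 / s) ^ t * ((L + μ) / 2 * D ^ 2) := by
    intro t
    induction t with
    | zero =>
      have h1 := le_quadratic_of_gradient_lipschitz hf hsmooth xs (x 0 - xs)
      rw [hgrad, inner_zero_left, add_sub_cancel] at h1
      have h2 : ‖x 0 - xs‖ ^ 2 ≤ D ^ 2 := by gcongr
      rw [hy0, sub_self, smul_zero, add_zero, pow_zero, one_mul]
      nlinarith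
    | succ t ih =>
      have hdesc : f (y (t + 1)) ≤ f (x t) - 1 / (2 * L) * ‖gradient f (x t)‖ ^ 2 := by
        have h1 := le_quadratic_of_gradient_lipschitz hf hsmooth (x t)
          (-((1 / L) • gradient f (x t)))
        rw [← sub_eq_add_neg, ← hy, inner_neg_right, inner_smul_right, norm_neg, norm_smul,
          real_inner_self_eq_norm_sq, Real.norm_of_nonneg (by positivity)] at h1
        refine h1.trans_eq ?_
        field_simp
        ring
      have hfs := quadratic_le_of_strongly_convex hf hconv (x t) (-(x t - xs))
      have hfy := quadratic_le_of_strongly_convex hf hconv (x t) (-(x t - y t))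
      rw [inner_neg_right, norm_neg, neg_sub, add_sub_cancel, ← sub_eq_add_neg] at hfs hfy
      have hfy' : f (x t) - inner ℝ (gradient f (x t)) (x t - y t) ≤ f (y t) := by
        have : 0 ≤ μ / 2 * ‖x t - y t‖ ^ 2 := by positivity
        linarith
      have hstep := agd_potential_step hμ hs hL (x t - y t) (x t - xs) (gradient f (x t))
        hdesc hfs hfy'
      have e : (x (t + 1) - xs) + s • (x (t + 1) - y (t + 1))
          = (x t - xs) + (s - 1) • (x t - y t) - (s / L) • gradient f (x t) := by
        have hsγ : γ + s * γ = s - 1 := by rw [hγ]; field_simp; ring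
        have e1 : (x (t + 1) - xs) + s • (x (t + 1) - y (t + 1))
            = (y (t + 1) - xs) + (γ + s * γ) • (y (t + 1) - y t) := by
          rw [hx]; module
        rw [e1, hsγ, hy]
        module
      rw [e]
      calc _ ≤ _ := hstep
        _ ≤ (1 - 1 / s) * ((1 - 1 / s) ^ t * ((L + μ) / 2 * D ^ 2)) :=
          mul_le_mul_of_nonneg_left ih hθ
        _ = _ := by ring
  have h1 := quadratic_le_of_strongly_convex hf hconv xs (y t - xs)
  rw [hgrad, inner_zero_left, add_sub_cancel] at h1
  have h2 : 0 ≤ μ / 2 * ‖(x t - xs) + s • (x t - y t)‖ ^ 2 := by positivity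
  have h3 := hpot t
  have h4 : (1 - 1 / s) ^ t * ((L + μ) / 2 * D ^ 2)
      = μ / 2 * ((1 - 1 / s) ^ t * ((s ^ 2 + 1) * D ^ 2)) := by rw [hL]; ring
  exact le_of_mul_le_mul_left (by linarith) (half_pos hμ)

end Gradient

/-- Closed form of a second-order linear recurrence with geometric forcing and zero initial data,
where `φp`, `φm` are the distinct roots of `z² = a z + b`. -/
lemma geometric_forced_recurrence_eq {σ a b φp φm K c0 : ℝ} (hσ : σ ≠ 0) (hφ : φp ≠ φm)
    (hp2 : φp ^ 2 = a * φp + b) (hm2 : φm ^ 2 = a * φm + b)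
    (hc0 : c0 * (σ ^ 2 - a * σ - b) = σ ^ 2 * K) {r : ℕ → ℝ}
    (h0 : r 0 = 0) (h1 : r 1 = 0)
    (hr : ∀ t, r (t + 2) = σ ^ t * K + a * r (t + 1) + b * r t) (t : ℕ) :
    r t = c0 / σ ^ 2 * σ ^ t - c0 / σ ^ 2 * (σ - φm) / (φp - φm) * φp ^ t
      + c0 / σ ^ 2 * (σ - φp) / (φp - φm) * φm ^ t := by
  have hφ' : φp - φm ≠ 0 := sub_ne_zero.2 hφ
  induction t using Nat.twoStepInduction with
  | zero => rw [h0]; field_simp; ring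
  | one => rw [h1]; field_simp; ring
  | more t ih ih' =>
    have hK : K = c0 / σ ^ 2 * (σ ^ 2 - a * σ - b) := by field_simp; linarith
    rw [hr, ih, ih', hK, pow_add φp t 2, pow_add φm t 2, hp2, hm2]
    ring


/-- Nonasymptotic convergence of DQ-AGD. -/
theorem dqagd_nonasymptotic_convergence (n : ℕ) (hn : 1 ≤ n)
    (L μ D : ℝ) (hμ : 0 < μ) (hμL : μ < L) (hD : 0 < D)
    (κ η γ σAGD lam : ℝ)
    (hκ : κ = L / μ) (hη : η = 1 / L)
    (hγ : γ = (Real.sqrt κ - 1) / (Real.sqrt κ + 1))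
    (hσ : σAGD = Real.sqrt (1 - 1 / Real.sqrt κ))
    (hlam : lam = (1 + γ + γ / σAGD) * Real.sqrt (κ + 1))
    (f : EuclideanSpace ℝ (Fin n) → ℝ) (hf : Differentiable ℝ f)
    (hsmooth : ∀ x y : EuclideanSpace ℝ (Fin n),
      ‖gradient f x - gradient f y‖ ≤ L * ‖x - y‖)
    (hconv : ConvexOn ℝ Set.univ (fun x : EuclideanSpace ℝ (Fin n) => f x - μ / 2 * ‖x‖ ^ 2))
    (xs : EuclideanSpace ℝ (Fin n)) (hmin : ∀ x, f xs ≤ f x)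
    (q : EuclideanSpace ℝ (Fin n) → EuclideanSpace ℝ (Fin n))
    (ε : ℝ) (hε : 0 < ε)
    (hq : ∀ v : EuclideanSpace ℝ (Fin n), ‖v‖ ≤ 1 → ‖q v - v‖ ≤ ε)
    (xh yh u : ℕ → EuclideanSpace ℝ (Fin n))
    (e : ℤ → EuclideanSpace ℝ (Fin n)) (r : ℤ → ℝ)
    (he1 : e (-1) = 0) (he2 : e (-2) = 0) (hyh0 : yh 0 = xh 0)
    (hr1 : r (-1) = 0) (hr2 : r (-2) = 0)
    (hrrec : ∀ t : ℕ, r (t : ℤ) = σAGD ^ t * L * D * lam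
      + ε * (r ((t : ℤ) - 1) + γ * (r ((t : ℤ) - 1) + r ((t : ℤ) - 2))))
    (m : ℕ → EuclideanSpace ℝ (Fin n))
    (hm : ∀ t : ℕ, m t = e ((t : ℤ) - 1) + γ • (e ((t : ℤ) - 1) - e ((t : ℤ) - 2)))
    (hu : ∀ t : ℕ, u t = gradient f (xh t + η • m t) - m t)
    (he : ∀ t : ℕ, e (t : ℤ) = r (t : ℤ) • q ((r (t : ℤ))⁻¹ • u t) - u t)
    (hyh : ∀ t : ℕ, yh (t + 1) = xh t - η • (u t + e (t : ℤ)))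
    (hxh : ∀ t : ℕ, xh (t + 1) = yh (t + 1) + γ • (yh (t + 1) - yh t))
    (hinit : ‖xs - xh 0‖ ≤ D)
    (φp φm : ℝ)
    (hφp : φp = (ε * (1 + γ) + Real.sqrt (ε ^ 2 * (1 + γ) ^ 2 + 4 * ε * γ)) / 2)
    (hφm : φm = (ε * (1 + γ) - Real.sqrt (ε ^ 2 * (1 + γ) ^ 2 + 4 * ε * γ)) / 2)
    (hε1 : ε ≤ 1)
    (hp : σAGD ^ 2 - ε * (1 + γ) * σAGD - ε * γ ≠ 0)
    (c0 cp cm c : ℝ)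
    (hc0 : c0 = σAGD ^ 2 * (L * D * lam) / (σAGD ^ 2 - ε * (1 + γ) * σAGD - ε * γ))
    (hcp : cp = -(c0 * φp ^ 2 / σAGD ^ 2) * (σAGD - φm) / (φp - φm))
    (hcm : cm = (c0 * φm ^ 2 / σAGD ^ 2) * (σAGD - φp) / (φp - φm))
    (hc : c = Real.sqrt (κ + 1) * D + η * c0 / σAGD) :
    ∀ t : ℕ, 1 ≤ t →
      ‖yh t - xs‖ ≤ σAGD ^ t * c + η * cp * φp ^ (t - 1) + η * cm * φm ^ (t - 1) := by
  have hL0 : 0 < L := hμ.trans hμL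
  have hκ1 : 1 < κ := by rw [hκ, one_lt_div hμ]; exact hμL
  have hκ0 : 0 < κ := by linarith
  set s := Real.sqrt κ with hs_def
  have hss : s ^ 2 = κ := Real.sq_sqrt hκ0.le
  have hs : 1 < s := by rw [hs_def, Real.lt_sqrt zero_le_one]; simpa using hκ1
  have hs0 : 0 < s := by linarith
  have hLs : L = μ * s ^ 2 := by rw [hss, hκ]; field_simp
  have hθ : 0 < 1 - 1 / s := by rw [sub_pos, div_lt_one hs0]; exact hs
  have hσ0 : 0 < σAGD := by rw [hσ]; exact Real.sqrt_pos.2 hθ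
  have hσσ : σAGD ^ 2 = 1 - 1 / s := by rw [hσ]; exact Real.sq_sqrt hθ.le
  have hγ0 : 0 < γ := by rw [hγ]; exact div_pos (by linarith) (by linarith)
  have hη0 : 0 < η := by rw [hη]; positivity
  have hk1 : 1 ≤ Real.sqrt (κ + 1) := Real.one_le_sqrt.2 (by linarith)
  have hk0 : 0 < Real.sqrt (κ + 1) := by linarith
  have hlam0 : 0 < lam := by rw [hlam]; positivity
  have hlam1 : 1 ≤ lam := by
    have : 0 ≤ γ / σAGD := by positivity
    rw [hlam]
    nlinarith
  -- the recurrence and the errors, shifted so as to start at `0`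
  have hcast2 (t : ℕ) : ((t + 2 : ℕ) : ℤ) - 2 = t := by push_cast; ring
  have hcast1 (t : ℕ) : ((t + 1 : ℕ) : ℤ) - 2 = (t : ℤ) - 1 := by push_cast; ring
  obtain ⟨R, hR⟩ : ∃ R : ℕ → ℝ, ∀ t : ℕ, R t = r ((t : ℤ) - 2) := ⟨_, fun _ => rfl⟩
  have hR2 (t : ℕ) : R (t + 2) = r t := by rw [hR, hcast2]
  have hR1 (t : ℕ) : R (t + 1) = r ((t : ℤ) - 1) := by rw [hR, hcast1]
  have hR_zero : R 0 = 0 := by rw [hR]; simpa using hr2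
  have hR_one : R 1 = 0 := by rw [hR]; simpa using hr1
  have hRrec (t : ℕ) : R (t + 2) = σAGD ^ t * (L * D * lam) + ε * (1 + γ) * R (t + 1)
      + ε * γ * R t := by
    rw [hR2, hR1, hR, hrrec]; ring
  have hRnn (t : ℕ) : 0 ≤ R t := by
    induction t using Nat.twoStepInduction with
    | zero => exact hR_zero.ge
    | one => exact hR_one.ge
    | more t ih ih' => rw [hRrec]; positivity
  have hrpos (t : ℕ) : 0 < r t := by
    have h1 := hRnn t
    have h2 := hRnn (t + 1)
    rw [← hR2, hRrec]
    positivity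
  -- exact accelerated gradient descent
  obtain ⟨x, hx⟩ : ∃ x : ℕ → EuclideanSpace ℝ (Fin n), ∀ t, x t = xh t + η • m t :=
    ⟨_, fun _ => rfl⟩
  obtain ⟨y, hy⟩ : ∃ y : ℕ → EuclideanSpace ℝ (Fin n), ∀ t : ℕ, y t = yh t + η • e ((t : ℤ) - 1) :=
    ⟨_, fun _ => rfl⟩
  have hcast (t : ℕ) : ((t + 1 : ℕ) : ℤ) - 1 = t := by push_cast; ring
  have hx0 : x 0 = xh 0 := by rw [hx, hm]; simp [he1, he2]
  have hy0 : y 0 = x 0 := by rw [hx0, hy, ← hyh0]; simp [he1]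
  have hystep (t : ℕ) : y (t + 1) = x t - (1 / L) • gradient f (x t) := by
    rw [hy, hcast, hyh, hu, ← hx, ← hη, hx]
    module
  have hxstep (t : ℕ) : x (t + 1) = y (t + 1) + γ • (y (t + 1) - y t) := by
    rw [hx, hm, hcast, hcast1, hxh, hy, hy, hcast]
    module
  have hx0D : ‖x 0 - xs‖ ≤ D := by rw [hx0, norm_sub_rev]; exact hinit
  have hydist (t : ℕ) : ‖y t - xs‖ ≤ σAGD ^ t * (Real.sqrt (κ + 1) * D) := by
    have h := agd_norm_sq_le hμ hs hLs hγ hf hsmooth hconv hmin hy0 hystep hxstep hx0D t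
    rw [← pow_le_pow_iff_left₀ (norm_nonneg _) (by positivity) two_ne_zero]
    refine h.trans_eq ?_
    rw [← hσσ, hss, mul_pow, mul_pow, Real.sq_sqrt (by positivity)]
    ring
  have hgrad (t : ℕ) : ‖gradient f (x t)‖ ≤ σAGD ^ t * (L * D * lam) := by
    have h1 := hsmooth (x t) xs
    rw [gradient_eq_zero_of_forall_le hmin, sub_zero] at h1
    have h2 : ‖x t - xs‖ ≤ σAGD ^ t * (D * lam) := by
      cases t with
      | zero =>
        rw [pow_zero, one_mul]
        exact hx0D.trans (le_mul_of_one_le_right hD.le hlam1)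
      | succ t =>
        have e1 : x (t + 1) - xs = (1 + γ) • (y (t + 1) - xs) - γ • (y t - xs) := by
          rw [hxstep]; module
        calc ‖x (t + 1) - xs‖ ≤ (1 + γ) * ‖y (t + 1) - xs‖ + γ * ‖y t - xs‖ := by
              rw [e1]
              refine (norm_sub_le _ _).trans_eq ?_
              rw [norm_smul, norm_smul, Real.norm_of_nonneg (by positivity),
                Real.norm_of_nonneg hγ0.le]
          _ ≤ (1 + γ) * (σAGD ^ (t + 1) * (Real.sqrt (κ + 1) * D))
              + γ * (σAGD ^ t * (Real.sqrt (κ + 1) * D)) := by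
              gcongr
              · exact hydist _
              · exact hydist _
          _ = σAGD ^ (t + 1) * (D * lam) := by
              rw [hlam]; field_simp
              ring
    calc _ ≤ _ := h1
      _ ≤ L * (σAGD ^ t * (D * lam)) := by gcongr
      _ = _ := by ring
  -- the quantizer never saturates
  have herr (t : ℕ) : ‖e ((t : ℤ) - 2)‖ ≤ ε * R t := by
    induction t using Nat.twoStepInduction with
    | zero => simp [he2, hR_zero]
    | one => simp [he1, hR_one]
    | more t ih ih' =>
      rw [hcast1] at ih'
      have hmt : ‖m t‖ ≤ ε * (1 + γ) * R (t + 1) + ε * γ * R t := by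
        have e1 : m t = (1 + γ) • e ((t : ℤ) - 1) - γ • e ((t : ℤ) - 2) := by
          rw [hm]; module
        calc ‖m t‖ ≤ (1 + γ) * ‖e ((t : ℤ) - 1)‖ + γ * ‖e ((t : ℤ) - 2)‖ := by
              rw [e1]
              refine (norm_sub_le _ _).trans_eq ?_
              rw [norm_smul, norm_smul, Real.norm_of_nonneg (by positivity),
                Real.norm_of_nonneg hγ0.le]
          _ ≤ (1 + γ) * (ε * R (t + 1)) + γ * (ε * R t) := by gcongr
          _ = _ := by ring
      have hut : ‖u t‖ ≤ r t := by
        rw [hu, ← hx, ← hR2, hRrec]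
        linarith [norm_sub_le (gradient f (x t)) (m t), hgrad t]
      have hr0 := hrpos t
      have hqt := hq ((r t)⁻¹ • u t) (by
        rw [norm_smul, norm_inv, Real.norm_of_nonneg hr0.le, ← div_eq_inv_mul]
        exact div_le_one_of_le₀ hut hr0.le)
      have e2 : e t = r t • (q ((r t)⁻¹ • u t) - (r t)⁻¹ • u t) := by
        rw [he, smul_sub, smul_inv_smul₀ hr0.ne']
      rw [hcast2, e2, hR2, norm_smul, Real.norm_of_nonneg hr0.le, mul_comm ε]
      gcongr
  -- closed form of the scaling factors
  have hdisc : 0 < ε ^ 2 * (1 + γ) ^ 2 + 4 * ε * γ := by positivity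
  have hsq := Real.sq_sqrt hdisc.le
  have hφ : φp ≠ φm := by
    have := Real.sqrt_pos.2 hdisc
    rw [hφp, hφm]
    intro h
    linarith
  have hclosed := geometric_forced_recurrence_eq (K := L * D * lam) (c0 := c0) hσ0.ne' hφ
    (a := ε * (1 + γ)) (b := ε * γ) (by rw [hφp]; linear_combination hsq / 4)
    (by rw [hφm]; linear_combination hsq / 4)
    (by rw [hc0]; exact div_mul_cancel₀ _ hp) hR_zero hR_one hRrec
  intro t ht
  obtain ⟨k, rfl⟩ := Nat.exists_eq_add_of_le' ht
  have e1 : yh (k + 1) - xs = (y (k + 1) - xs) - η • e (k : ℤ) := by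
    rw [hy, hcast]; module
  have he_le : ‖e (k : ℤ)‖ ≤ R (k + 2) := by
    have := herr (k + 2)
    rw [hcast2] at this
    exact this.trans (mul_le_of_le_one_left (hRnn _) hε1)
  calc ‖yh (k + 1) - xs‖ ≤ ‖y (k + 1) - xs‖ + η * ‖e (k : ℤ)‖ := by
        rw [e1]
        refine (norm_sub_le _ _).trans_eq ?_
        rw [norm_smul, Real.norm_of_nonneg hη0.le]
    _ ≤ σAGD ^ (k + 1) * (Real.sqrt (κ + 1) * D) + η * R (k + 2) := by
        gcongr
        exact hydist _
    _ = _ := by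
        have hφ' : φp - φm ≠ 0 := sub_ne_zero.2 hφ
        rw [hclosed, hc, hcp, hcm, Nat.add_sub_cancel]
        field_simp
        ring
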